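/- Let λ ≤ μ be dyadic, u_λ frequency-localized at λ and v_μ at μ. Then for any direction θ, ‖u_λ · S_θ' v_μ‖_{L²(ℝⁿ×ℝ)} ≲ ‖u_λ‖_{L²_{x_θ}L^∞_{x'_θ,t}} ‖S_θ' v_μ‖_{L^∞_{x_θ}L²_{x'_θ,t}}; in particular, with u_λ in the maximal space (norm λ^{(n-1)/2}) and v_μ in the smoothing space (norm μ^{-1/2}), the product is bounded in L² by λ^{n/2}(λμ)^{-1/2} times the respective dyadic space norms, which shows the product u_λ v_μ truncated to modulations ≲ λμ lies in X^{0,1/2,1} with norm ≲ λ^{n/2} ‖u_λ‖ ‖v_μ‖. -/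

import Mathlib

open MeasureTheory Complex
open scoped ENNReal RealInnerProductSpace

noncomputable section

abbrev Rn (n : ℕ) := EuclideanSpace ℝ (Fin n)

/-- Space-time Fourier transform. -/
def ftST {n : ℕ} (f : Rn n × ℝ → ℂ) (q : Rn n × ℝ) : ℂ :=
  ∫ p : Rn n × ℝ, Complex.exp (-Complex.I * ((⟪p.1, q.1⟫ : ℝ) + p.2 * q.2)) * f p

/-- Space-time Fourier multiplier operator. -/
def fourierMult {n : ℕ} (m : Rn n × ℝ → ℂ) (f : Rn n × ℝ → ℂ) (p : Rn n × ℝ) : ℂ :=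
  ∫ q : Rn n × ℝ,
    Complex.exp (Complex.I * ((⟪p.1, q.1⟫ : ℝ) + p.2 * q.2)) * m q * ftST f q

/-- Symbol of the modulation localization `M_d`, `d = 2^k`. -/
def modSymbol {n : ℕ} (s : ℝ → ℝ) (k : ℤ) (q : Rn n × ℝ) : ℂ :=
  ((s (|q.2 - ‖q.1‖ ^ 2| / 2 ^ k) : ℝ) : ℂ)

/-- Symbol of the modulation cutoff `M_{≤ d}`, `d = 2^k`. -/
def modLeSymbol {n : ℕ} (s : ℝ → ℝ) (k : ℤ) (q : Rn n × ℝ) : ℂ :=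
  ((∑' j : ℤ, if j ≤ k then s (|q.2 - ‖q.1‖ ^ 2| / 2 ^ j) else 0 : ℝ) : ℂ)

/-- The `X^{0,1/2,1}` norm. -/
def Xnorm1 {n : ℕ} (s : ℝ → ℝ) (f : Rn n × ℝ → ℂ) : ℝ≥0∞ :=
  ∑' k : ℤ, ENNReal.ofReal (Real.sqrt (2 ^ k)) *
    eLpNorm (fourierMult (modSymbol s k) f) 2 volume

/-- L² norm of the slice `{x·v_θ = a}`. -/
def sliceL2 {n : ℕ} (E : (ℝ × Rn (n - 1)) ≃L[ℝ] Rn n) (u : Rn n × ℝ → ℂ) (a : ℝ) : ℝ≥0∞ :=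
  eLpNorm (fun p : Rn (n - 1) × ℝ => u (E (a, p.1), p.2)) 2 volume

/-- Mixed norm `L^∞_{x_θ} L²_{t, x'_θ}`. -/
def normLinfL2 {n : ℕ} (E : (ℝ × Rn (n - 1)) ≃L[ℝ] Rn n) (u : Rn n × ℝ → ℂ) : ℝ≥0∞ :=
  essSup (sliceL2 E u) volume

/-- `L^∞` norm over the slice `{x·v_θ = a}`. -/
def sliceLinf {n : ℕ} (E : (ℝ × Rn (n - 1)) ≃L[ℝ] Rn n) (u : Rn n × ℝ → ℂ) (a : ℝ) : ℝ≥0∞ :=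
  essSup (fun p : Rn (n - 1) × ℝ => (‖u (E (a, p.1), p.2)‖₊ : ℝ≥0∞)) volume

/-- Mixed norm `L²_{x_θ} L^∞_{t, x'_θ}`. -/
def normL2Linf {n : ℕ} (E : (ℝ × Rn (n - 1)) ≃L[ℝ] Rn n) (u : Rn n × ℝ → ℂ) : ℝ≥0∞ :=
  (∫⁻ a : ℝ, (sliceLinf E u a) ^ 2) ^ (1 / 2 : ℝ)

section gen
variable {V : Type*} [NormedAddCommGroup V] [InnerProductSpace ℝ V] [FiniteDimensional ℝ V]
  [MeasurableSpace V] [BorelSpace V]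
open FourierTransform SchwartzMap

lemma gen_duality {f g : V → ℂ} (hf : Integrable f volume) (hg : Integrable g volume) :
    ∫ x, 𝓕 f x * g x = ∫ x, f x * 𝓕 g x := by
  simpa using! (VectorFourier.integral_fourierIntegral_smul_eq_flip (L := innerₗ V) (μ := volume)
      (ν := volume) Real.continuous_fourierChar continuous_inner hf hg)

lemma gen_continuous {f : V → ℂ} (hf : Integrable f volume) : Continuous (𝓕 f) :=
  VectorFourier.fourierIntegral_continuous Real.continuous_fourierChar
    (L := innerₗ V) continuous_inner hf

lemma gen_ae_eq {f g : V → ℂ} (hf : LocallyIntegrable f volume) (hg : LocallyIntegrable g volume)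
    (h : ∀ φ : 𝓢(V, ℂ), ∫ x, φ x * f x = ∫ x, φ x * g x) : f =ᵐ[volume] g := by
  refine ae_eq_of_integral_contDiff_smul_eq hf hg fun φ h1 h2 => ?_
  have h2' : HasCompactSupport (fun x => (φ x : ℂ)) := h2.comp_left (g := fun y : ℝ => (y : ℂ)) (by simp)
  have h1' : ContDiff ℝ (⊤ : ℕ∞) (fun x => (φ x : ℂ)) := Complex.ofRealCLM.contDiff.comp h1
  simpa using h (h2'.toSchwartzMap h1')

lemma gen_inv {h : V → ℂ} (hh : Integrable h volume) (hh' : Integrable (𝓕 h) volume) :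
    𝓕 (𝓕 h) =ᵐ[volume] fun x => h (-x) := by
  refine gen_ae_eq (gen_continuous hh').locallyIntegrable hh.comp_neg.locallyIntegrable fun φ => ?_
  rw [← gen_duality φ.integrable hh']
  have : (𝓕 (φ : V → ℂ)) = ((𝓕 φ : 𝓢(V, ℂ)) : V → ℂ) := (fourier_coe φ).symm
  rw [this, ← gen_duality (𝓕 φ).integrable hh]
  rw [← integral_neg_eq_self]
  congr 1
  ext x
  congr 1
  rw [← Real.fourierInv_eq_fourier_neg, ← fourierInv_coe]
  simp

lemma gen_planch {h : V → ℂ} (hh : Integrable h volume) (h2 : MemLp h 2 volume) :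
    eLpNorm (𝓕 h) 2 volume = eLpNorm h 2 volume := by
  have key : 𝓕 h =ᵐ[volume] (𝓕 (h2.toLp h) : Lp ℂ 2 (volume : Measure V)) := by
    refine gen_ae_eq (gen_continuous hh).locallyIntegrable
      ((Lp.memLp _).locallyIntegrable (by norm_num)) fun φ => ?_
    rw [← gen_duality φ.integrable hh]
    have e := congrArg (fun T : 𝓢'(V, ℂ) => T φ) (Lp.fourier_toTemperedDistribution_eq (h2.toLp h))
    simp only [TemperedDistribution.fourier_apply, Lp.toTemperedDistribution_apply, smul_eq_mul] at e
    rw [← e]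
    refine integral_congr_ae ?_
    filter_upwards [h2.coeFn_toLp] with x hx
    rw [hx, fourier_coe]
  rw [eLpNorm_congr_ae key]
  have := Lp.norm_fourier_eq (h2.toLp h)
  rw [Lp.norm_def, Lp.norm_def, ENNReal.toReal_eq_toReal_iff' (Lp.eLpNorm_ne_top _) (Lp.eLpNorm_ne_top _)] at this
  rw [this, eLpNorm_congr_ae h2.coeFn_toLp]

end gen

section tr
open FourierTransform
variable {n : ℕ}

lemma ftST_eq (f : Rn n × ℝ → ℂ) (q : Rn n × ℝ) :
    ftST f q = 𝓕 (fun w : WithLp 2 (Rn n × ℝ) => f w.ofLp)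
      ((2 * Real.pi)⁻¹ • WithLp.toLp 2 q) := by
  rw [Real.fourier_eq', ftST]
  rw [← (WithLp.volume_preserving_ofLp (Rn n) ℝ).integral_comp
    (MeasurableEquiv.toLp 2 (Rn n × ℝ)).symm.measurableEmbedding]
  congr 1
  ext w
  rw [smul_eq_mul]
  congr 2
  have : (2 * Real.pi : ℝ) ≠ 0 := by positivity
  rw [inner_smul_right, WithLp.prod_inner_apply]
  simp only [RCLike.inner_apply, conj_trivial]
  rw [show -2 * Real.pi * ((2 * Real.pi)⁻¹ * (⟪w.ofLp.1, q.1⟫ + q.2 * w.ofLp.2))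
    = - ((2 * Real.pi) * (2 * Real.pi)⁻¹) * (⟪w.ofLp.1, q.1⟫ + q.2 * w.ofLp.2) by ring,
    mul_inv_cancel₀ this]
  push_cast
  ring

lemma ftST_nonint (f : Rn n × ℝ → ℂ) (hf : ¬ Integrable f volume) : ftST f = 0 := by
  ext q
  apply integral_undef
  contrapose hf
  have : Integrable (fun p : Rn n × ℝ => Complex.exp (Complex.I * ((⟪p.1, q.1⟫ : ℝ) + p.2 * q.2)) *
    (Complex.exp (-Complex.I * ((⟪p.1, q.1⟫ : ℝ) + p.2 * q.2)) * f p)) volume := by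
    refine hf.bdd_mul (c := 1) (by fun_prop) (.of_forall fun p => ?_)
    rw [mul_comm, ← ofReal_mul, ← ofReal_add, norm_exp_ofReal_mul_I]
  refine this.congr (.of_forall fun p => ?_)
  simp only
  rw [← mul_assoc, ← Complex.exp_add]
  simp

lemma fourierMult_eq (m f : Rn n × ℝ → ℂ) (p : Rn n × ℝ) :
    fourierMult m f p = ftST (fun q => m q * ftST f q) (-p) := by
  rw [fourierMult, ftST]
  congr 1
  ext q
  rw [mul_assoc]
  congr 2
  simp only [Prod.fst_neg, Prod.snd_neg, inner_neg_right, real_inner_comm]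
  push_cast
  ring

lemma eLpNorm_ofLp {f : Rn n × ℝ → ℂ} (hf : AEStronglyMeasurable f volume) :
   eLpNorm (fun w : WithLp 2 (Rn n × ℝ) => f w.ofLp) 2 volume = eLpNorm f 2 volume :=
  eLpNorm_comp_measurePreserving hf (WithLp.volume_preserving_ofLp (Rn n) ℝ)

instance volNeg : (volume : Measure (Rn n × ℝ)).IsNegInvariant := by
  have : (volume : Measure (Rn n × ℝ)).IsAddHaarMeasure :=
    inferInstanceAs ((volume : Measure (Rn n)).prod (volume : Measure ℝ)).IsAddHaarMeasure
  infer_instance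

lemma eLpNorm_neg_comp (f : Rn n × ℝ → ℂ) :
   eLpNorm (fun w : Rn n × ℝ => f (-w)) 2 volume = eLpNorm f 2 volume := by
  have h := (MeasurableEquiv.neg (Rn n × ℝ)).measurableEmbedding.eLpNorm_map_measure
    (μ := volume) (g := f) (p := 2)
  rw [show Measure.map (⇑(MeasurableEquiv.neg (Rn n × ℝ))) volume = volume from
    Measure.map_neg_eq_self _] at h
  exact h.symm

lemma integrable_ofLp {f : Rn n × ℝ → ℂ} (hf : Integrable f volume) :
    Integrable (fun w : WithLp 2 (Rn n × ℝ) => f w.ofLp) volume :=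
  (WithLp.volume_preserving_ofLp (Rn n) ℝ).integrable_comp_of_integrable hf

lemma ftST_cont {f : Rn n × ℝ → ℂ} (hf : Integrable f volume) : Continuous (ftST f) := by
  have : ftST f = fun q => 𝓕 (fun w : WithLp 2 (Rn n × ℝ) => f w.ofLp)
      ((2 * Real.pi)⁻¹ • WithLp.toLp 2 q) := funext (ftST_eq f)
  rw [this]
  exact (gen_continuous (integrable_ofLp hf)).comp (by fun_prop)

lemma ftST_L2 (n : ℕ) : ∃ c : NNReal, ∀ f : Rn n × ℝ → ℂ,
    eLpNorm (ftST f) 2 volume ≤ c * eLpNorm f 2 volume := by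
  let r : ℝ := (2 * Real.pi)⁻¹
  have hr : r ≠ 0 := by positivity
  let c0 : ℝ≥0∞ := (ENNReal.ofReal |(r ^ Module.finrank ℝ (WithLp 2 (Rn n × ℝ)))⁻¹|)
    ^ (1 / (2 : ℝ≥0∞)).toReal
  have hc0 : c0 ≠ ∞ := ENNReal.rpow_ne_top_of_nonneg (by simp) (by simp)
  have hc1 : c0 ≠ 0 := by
    simp only [c0, ne_eq, ENNReal.rpow_eq_zero_iff]
    simp [hr]
  refine ⟨c0.toNNReal + 1, fun f => ?_⟩
  by_cases hf : Integrable f volume; swap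
  · rw [ftST_nonint f hf]; simp
  by_cases h2 : MemLp f 2 volume; swap
  · have : eLpNorm f 2 volume = ∞ := by
      by_contra h
      exact h2 ⟨hf.1, lt_top_iff_ne_top.2 h⟩
    rw [this, ENNReal.mul_top]
    · exact le_top
    · simp
  rw [← eLpNorm_ofLp (ftST_cont hf).aestronglyMeasurable]
  simp_rw [ftST_eq, WithLp.toLp_ofLp]
  have h := (Homeomorph.smulOfNeZero r hr (α := WithLp 2 (Rn n × ℝ))).measurableEmbedding.eLpNorm_map_measure
    (μ := volume) (g := 𝓕 (fun w : WithLp 2 (Rn n × ℝ) => f w.ofLp)) (p := 2)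
  rw [show Measure.map (⇑(Homeomorph.smulOfNeZero r hr (α := WithLp 2 (Rn n × ℝ)))) volume = _ from
    Measure.map_addHaar_smul volume hr, eLpNorm_smul_measure_of_ne_top (by simp),
    gen_planch (integrable_ofLp hf) (h2.comp_measurePreserving (WithLp.volume_preserving_ofLp (Rn n) ℝ)),
    eLpNorm_ofLp hf.1] at h
  refine (le_of_eq h.symm).trans ?_
  rw [smul_eq_mul]
  gcongr
  push_cast
  rw [ENNReal.coe_toNNReal hc0]
  exact le_self_add

lemma ftST_inv (n : ℕ) : ∃ c : ℝ, ∀ f : Rn n × ℝ → ℂ, Integrable f volume →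
    Integrable (ftST f) volume → ∀ᵐ q, ftST (ftST f) q = c * f (-q) := by
  let r : ℝ := (2 * Real.pi)⁻¹
  have hr : r ≠ 0 := by positivity
  refine ⟨|(r ^ Module.finrank ℝ (WithLp 2 (Rn n × ℝ)))⁻¹|, fun f hf hf' => ?_⟩
  have hi := integrable_ofLp hf'
  simp_rw [ftST_eq f, WithLp.toLp_ofLp] at hi
  have hi' : Integrable (𝓕 (fun w : WithLp 2 (Rn n × ℝ) => f w.ofLp)) volume :=
    (integrable_comp_smul_iff volume _ hr).1 hi
  have key := gen_inv (integrable_ofLp hf) hi'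
  have key2 := (WithLp.volume_preserving_toLp (Rn n) ℝ).quasiMeasurePreserving.ae key
  filter_upwards [key2] with q hq
  have hq' : f (-q) = 𝓕 (𝓕 (fun w : WithLp 2 (Rn n × ℝ) => f w.ofLp)) (WithLp.toLp 2 q) := hq.symm
  rw [hq', ftST_eq]
  simp_rw [ftST_eq f, WithLp.toLp_ofLp]
  rw [Real.fourier_eq', Real.fourier_eq' (𝓕 (fun w : WithLp 2 (Rn n × ℝ) => f w.ofLp))]
  have := Measure.integral_comp_smul volume (fun v : WithLp 2 (Rn n × ℝ) =>
    cexp (↑(-2 * Real.pi * ⟪v, WithLp.toLp 2 q⟫) * I) •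
      𝓕 (fun w : WithLp 2 (Rn n × ℝ) => f w.ofLp) v) r
  rw [Complex.real_smul] at this
  rw [← this]
  simp_rw [inner_smul_left, inner_smul_right]
  rfl


lemma ftST_neg (f : Rn n × ℝ → ℂ) (q : Rn n × ℝ) :
    ftST (fun p => f (-p)) q = ftST f (-q) := by
  rw [ftST, ftST, ← integral_neg_eq_self]
  simp

lemma ftST_zero : ftST (0 : Rn n × ℝ → ℂ) = 0 := by
  ext q
  simp [ftST]

lemma ftST_fourierMult_zero (m f : Rn n × ℝ → ℂ) :
    ∀ᵐ q, m q = 0 → ftST (fourierMult m f) q = 0 := by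
  obtain ⟨c, hc⟩ := ftST_inv n
  have e : fourierMult m f = fun p => ftST (fun q => m q * ftST f q) (-p) :=
    funext (fourierMult_eq m f)
  by_cases hh : Integrable (fun q => m q * ftST f q) volume; swap
  · rw [e, ftST_nonint _ hh]
    have : (fun p : Rn n × ℝ => (0 : Rn n × ℝ → ℂ) (-p)) = 0 := rfl
    rw [this, ftST_zero]
    simp
  by_cases hg : Integrable (fourierMult m f) volume; swap
  · rw [ftST_nonint _ hg]
    simp
  have hg' : Integrable (ftST (fun q => m q * ftST f q)) volume := by
    rw [e] at hg
    simpa using hg.comp_neg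
  have key := (Measure.measurePreserving_neg (volume : Measure (Rn n × ℝ))).quasiMeasurePreserving.ae
    (hc _ hh hg')
  filter_upwards [key] with q hq hm
  rw [e, ftST_neg, hq]
  simp [hm]

lemma fourierMult_L2 {c : NNReal} (hc : ∀ f : Rn n × ℝ → ℂ,
    eLpNorm (ftST f) 2 volume ≤ c * eLpNorm f 2 volume) (m f : Rn n × ℝ → ℂ) :
    eLpNorm (fourierMult m f) 2 volume ≤ c * eLpNorm (fun q => m q * ftST f q) 2 volume := by
  have e : fourierMult m f = fun p => ftST (fun q => m q * ftST f q) (-p) :=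
    funext (fourierMult_eq m f)
  rw [e, eLpNorm_neg_comp]
  exact hc _

lemma mul_L2 {B : NNReal} {m : Rn n × ℝ → ℂ} (hm : ∀ q, ‖m q‖ ≤ B) (f : Rn n × ℝ → ℂ) :
    eLpNorm (fun q => m q * f q) 2 volume ≤ B * eLpNorm f 2 volume := by
  refine eLpNorm_le_nnreal_smul_eLpNorm_of_ae_le_mul (.of_forall fun q => ?_) 2
  rw [nnnorm_mul]
  gcongr
  exact hm q

end tr

section sym

lemma s_bdd (s : ℝ → ℝ) (hs : ContDiff ℝ (⊤ : ℕ∞) s)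
    (hsupp : Function.support s ⊆ Set.Ioo (1 / 2) 2) : ∃ B : NNReal, ∀ x, |s x| ≤ B := by
  have : HasCompactSupport s :=
    HasCompactSupport.of_support_subset_isCompact (isCompact_Icc (a := (1/2 : ℝ)) (b := 2))
      (hsupp.trans Set.Ioo_subset_Icc_self)
  obtain ⟨B, hB⟩ := hs.continuous.bounded_above_of_compact_support this
  exact ⟨B.toNNReal, fun x => (hB x).trans (Real.le_coe_toNNReal B)⟩

lemma sum_bdd {s : ℝ → ℝ} (hsupp : Function.support s ⊆ Set.Ioo (1 / 2) 2) {B : NNReal}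
    (hB : ∀ x, |s x| ≤ B) (k : ℤ) (x : ℝ) (hx : 0 ≤ x) :
    |∑' j : ℤ, if j ≤ k then s (x / 2 ^ j) else 0| ≤ 2 * B := by
  have hz : ∀ y, s y ≠ 0 → 1 / 2 < y ∧ y < 2 := fun y hy => hsupp hy
  rw [tsum_eq_sum (s := {Int.log 2 x, Int.log 2 x + 1})]
  · rw [Finset.sum_pair (by simp)]
    have hb : ∀ j : ℤ, |if j ≤ k then s (x / 2 ^ j) else 0| ≤ B := by
      intro j
      split_ifs
      · exact hB _
      · simp
    refine (abs_add_le _ _).trans ?_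
    linarith [hb (Int.log 2 x), hb (Int.log 2 x + 1)]
  · intro j hj
    split_ifs with hjk
    swap
    · rfl
    by_contra hne
    obtain ⟨h1, h2⟩ := hz _ hne
    have hp : (0 : ℝ) < 2 ^ j := by positivity
    rw [lt_div_iff₀ hp] at h1
    rw [div_lt_iff₀ hp] at h2
    have hx0 : 0 < x := by linarith
    have l1 := Int.zpow_log_le_self (b := 2) (by norm_num) hx0
    have l2 := Int.lt_zpow_succ_log_self (b := 2) (by norm_num) x
    push_cast at l1 l2
    have e1 : (2 : ℝ) ^ (Int.log 2 x) < 2 ^ (j + 1) := by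
      rw [zpow_add₀ (by norm_num)]
      linarith
    have e2 : (2 : ℝ) ^ j < 2 ^ (Int.log 2 x + 1 + 1) := by
      rw [zpow_add₀ (by norm_num)]
      linarith
    rw [zpow_lt_zpow_iff_right₀ (by norm_num)] at e1 e2
    simp only [Finset.mem_insert, Finset.mem_singleton] at hj
    omega

lemma mod_zero {n : ℕ} {s : ℝ → ℝ} (hsupp : Function.support s ⊆ Set.Ioo (1 / 2) 2)
    (k K : ℤ) (hk : K + 1 < k) (q : Rn n × ℝ) (hq : modSymbol s k q ≠ 0) :
    modLeSymbol s K q = 0 := by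
  have hz : ∀ y, s y ≠ 0 → 1 / 2 < y ∧ y < 2 := fun y hy => hsupp hy
  rw [modSymbol, Complex.ofReal_ne_zero] at hq
  obtain ⟨h1, h2⟩ := hz _ hq
  rw [lt_div_iff₀ (by positivity)] at h1
  rw [modLeSymbol, Complex.ofReal_eq_zero]
  convert tsum_zero with j
  split_ifs with hj
  swap
  · rfl
  by_contra hne
  obtain ⟨h3, h4⟩ := hz _ hne
  rw [div_lt_iff₀ (by positivity)] at h4
  have : (2 : ℝ) ^ k < 2 ^ (j + 1 + 1) := by
    rw [zpow_add₀ (by norm_num), zpow_add₀ (by norm_num)]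
    linarith
  rw [zpow_lt_zpow_iff_right₀ (by norm_num)] at this
  omega

lemma geo : ∃ G : NNReal, ∀ (J : ℤ) (A : ℝ≥0∞) (a : ℤ → ℝ≥0∞), (∀ k, a k ≤ A) →
    (∀ k, J + 6 < k → a k = 0) →
    ∑' k : ℤ, ENNReal.ofReal (Real.sqrt (2 ^ k)) * a k ≤
      G * ENNReal.ofReal (Real.sqrt (2 ^ J)) * A := by
  let r : ℝ≥0∞ := ENNReal.ofReal (Real.sqrt (2⁻¹))
  have hr : r < 1 := by
    rw [ENNReal.ofReal_lt_one, Real.sqrt_lt' one_pos]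
    norm_num
  have hG : (1 - r)⁻¹ ≠ ∞ := by
    rw [ENNReal.inv_ne_top]
    exact (tsub_pos_of_lt hr).ne'
  refine ⟨(Real.sqrt (2 ^ 6)).toNNReal * (1 - r)⁻¹.toNNReal, fun J A a ha ha0 => ?_⟩
  have hinj : Function.Injective (fun m : ℕ => J + 6 - (m : ℤ)) := by
    intro x y h
    simp only at h
    omega
  rw [← hinj.tsum_eq]
  · calc ∑' m : ℕ, ENNReal.ofReal (Real.sqrt (2 ^ (J + 6 - (m : ℤ)))) * a (J + 6 - m)
        ≤ ∑' m : ℕ, (ENNReal.ofReal (Real.sqrt (2 ^ 6)) * ENNReal.ofReal (Real.sqrt (2 ^ J)) * A)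
            * r ^ m := by
          refine ENNReal.tsum_le_tsum fun m => ?_
          have : Real.sqrt (2 ^ (J + 6 - (m : ℤ)))
            = Real.sqrt (2 ^ 6) * Real.sqrt (2 ^ J) * Real.sqrt (2⁻¹) ^ m := by
            rw [zpow_sub₀ (by norm_num), zpow_add₀ (by norm_num), div_eq_mul_inv,
              Real.sqrt_mul (by positivity), Real.sqrt_mul (by positivity)]
            have hq : Real.sqrt (((2 : ℝ) ^ (m : ℤ))⁻¹) = Real.sqrt (2⁻¹) ^ m := by
              rw [zpow_natCast, ← inv_pow, Real.sqrt_eq_iff_mul_self_eq (by positivity)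
                (by positivity), ← mul_pow, Real.mul_self_sqrt (by positivity)]
            have h6 : ((2 : ℝ) ^ (6 : ℤ)) = 2 ^ 6 := by norm_num
            rw [hq, h6]
            ring
          rw [this, ENNReal.ofReal_mul (by positivity), ENNReal.ofReal_mul (by positivity),
            ENNReal.ofReal_pow (by positivity)]
          calc _ ≤ ENNReal.ofReal √(2 ^ 6) * ENNReal.ofReal √(2 ^ J) * ENNReal.ofReal √2⁻¹ ^ m * A := by
                gcongr
                exact ha _
            _ = _ := by ring
      _ = _ := by
          rw [ENNReal.tsum_mul_left, ENNReal.tsum_geometric, ENNReal.coe_mul,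
            ENNReal.coe_toNNReal hG]
          change _ = ENNReal.ofReal _ * _ * _ * _
          ring
  · intro k hk
    rw [Function.mem_support] at hk
    have : ¬ (J + 6 < k) := fun h => hk (by rw [ha0 k h, mul_zero])
    exact ⟨(J + 6 - k).toNat, by simp only; omega⟩

end sym

section hol
variable {n : ℕ}

lemma eLpNorm_sq {α : Type*} [MeasurableSpace α] (μ : Measure α) (f : α → ℂ) :
    (eLpNorm f 2 μ) ^ 2 = ∫⁻ x, ‖f x‖ₑ ^ 2 ∂μ := by
  have := eLpNorm_nnreal_pow_eq_lintegral (f := f) (μ := μ) (p := 2) (by norm_num)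
  simpa using this

lemma essSup_meas {α β : Type*} [MeasurableSpace α] [MeasurableSpace β] (ν : Measure β) [SFinite ν]
    {g : α × β → ℝ≥0∞} (hg : Measurable g) : Measurable (fun a => essSup (fun b => g (a, b)) ν) := by
  refine measurable_of_Iic fun c => ?_
  have : (fun a => essSup (fun b => g (a, b)) ν) ⁻¹' Set.Iic c
      = {a | ν (Prod.mk a ⁻¹' {z | c < g z}) = 0} := by
    ext a
    simp only [Set.mem_preimage, Set.mem_Iic, Set.mem_ofPred_eq]
    constructor
    · intro h
      have h2 : ∀ᵐ b ∂ν, g (a, b) ≤ c := by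
        filter_upwards [ENNReal.ae_le_essSup (μ := ν) (fun b => g (a, b))] with b hb
        exact hb.trans h
      rw [ae_iff] at h2
      simpa [Set.preimage] using h2
    · intro h
      refine essSup_le_of_ae_le c ?_
      change ∀ᵐ b ∂ν, g (a, b) ≤ c
      rw [ae_iff]
      simpa [Set.preimage] using h
  rw [this]
  exact measurable_measure_prodMk_left (measurableSet_lt measurable_const hg) (measurableSet_singleton 0)

lemma holder (E : (ℝ × Rn (n - 1)) ≃L[ℝ] Rn n) (hE : MeasurePreserving (⇑E) volume volume)
    (uu vv : Rn n × ℝ → ℂ) (hu : AEStronglyMeasurable uu volume)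
    (hv : AEStronglyMeasurable vv volume) :
    eLpNorm (fun p : Rn n × ℝ => uu p * vv p) 2 volume ≤ normL2Linf E uu * normLinfL2 E vv := by
  let Φ : ℝ × (Rn (n - 1) × ℝ) → Rn n × ℝ := fun z => (E (z.1, z.2.1), z.2.2)
  have i1 : SFinite (volume : Measure (Rn n)) := inferInstance
  have i2 : SFinite (volume : Measure (ℝ × Rn (n - 1))) :=
    inferInstanceAs (SFinite ((volume : Measure ℝ).prod (volume : Measure (Rn (n - 1)))))
  have hA : MeasurePreserving (Prod.map (⇑E) (id : ℝ → ℝ))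
      ((volume : Measure (ℝ × Rn (n - 1))).prod (volume : Measure ℝ))
      ((volume : Measure (Rn n)).prod (volume : Measure ℝ)) :=
    MeasurePreserving.prod hE (MeasurePreserving.id (volume : Measure ℝ))
  have hP : MeasurePreserving
      (MeasurableEquiv.prodAssoc : (ℝ × Rn (n - 1)) × ℝ ≃ᵐ ℝ × (Rn (n - 1) × ℝ)).symm
      volume volume :=
    MeasurePreserving.symm _ (volume_preserving_prodAssoc (α₁ := ℝ) (β₁ := Rn (n - 1)) (γ₁ := ℝ))
  have hΦ : MeasurePreserving Φ volume volume := MeasurePreserving.comp hA hP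
  have hu' : AEStronglyMeasurable (uu ∘ Φ) ((volume : Measure ℝ).prod volume) :=
    hu.comp_measurePreserving hΦ
  have hv' : AEStronglyMeasurable (vv ∘ Φ) ((volume : Measure ℝ).prod volume) :=
    hv.comp_measurePreserving hΦ
  have hS : AEMeasurable (sliceLinf E uu) volume := by
    obtain ⟨w, hw, hwe⟩ := hu'
    have hm : Measurable (fun a : ℝ =>
        essSup (fun p : Rn (n - 1) × ℝ => ‖w (a, p)‖ₑ) volume) :=
      essSup_meas (α := ℝ) (β := Rn (n - 1) × ℝ) volume (g := fun z => ‖w z‖ₑ) hw.enorm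
    refine ⟨_, hm, ?_⟩
    filter_upwards [Measure.ae_ae_of_ae_prod hwe] with a ha
    refine essSup_congr_ae ?_
    filter_upwards [ha] with p hp
    rw [← hp]
    rfl
  rw [← ENNReal.pow_le_pow_left_iff two_ne_zero, eLpNorm_sq, mul_pow]
  have e1 : (normL2Linf E uu) ^ 2 = ∫⁻ a : ℝ, (sliceLinf E uu a) ^ 2 := by
    rw [normL2Linf, ← ENNReal.rpow_natCast, ← ENNReal.rpow_mul]
    norm_num
  rw [e1, ← lintegral_mul_const'' _ (hS.pow_const 2)]
  have e2 : ∫⁻ p, ‖uu p * vv p‖ₑ ^ 2 = ∫⁻ z, ‖uu (Φ z) * vv (Φ z)‖ₑ ^ 2 := by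
    rw [← hΦ.map_eq, lintegral_map' _ hΦ.measurable.aemeasurable]
    rw [hΦ.map_eq]
    exact (hu.mul hv).enorm.pow_const 2
  rw [e2]
  change ∫⁻ z, ‖uu (Φ z) * vv (Φ z)‖ₑ ^ 2 ∂((volume : Measure ℝ).prod volume) ≤ _
  rw [lintegral_prod (fun z => ‖uu (Φ z) * vv (Φ z)‖ₑ ^ 2) ((hu'.mul hv').enorm.pow_const 2)]
  refine lintegral_mono_ae ?_
  filter_upwards [hv'.prodMk_left, ENNReal.ae_le_essSup (μ := volume) (sliceL2 E vv)] with a ha hN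
  calc ∫⁻ p, ‖uu (Φ (a, p)) * vv (Φ (a, p))‖ₑ ^ 2
      ≤ ∫⁻ p, (sliceLinf E uu a) ^ 2 * ‖vv (Φ (a, p))‖ₑ ^ 2 := by
        refine lintegral_mono_ae ?_
        filter_upwards [ENNReal.ae_le_essSup (μ := volume)
          (fun p : Rn (n - 1) × ℝ => (‖uu (E (a, p.1), p.2)‖₊ : ℝ≥0∞))] with p hp
        rw [enorm_mul, mul_pow]
        gcongr
        exact hp
    _ = (sliceLinf E uu a) ^ 2 * (sliceL2 E vv a) ^ 2 := by
        have ha' : AEStronglyMeasurable (fun p => vv (Φ (a, p))) volume := ha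
        rw [lintegral_const_mul'' _ (ha'.enorm.pow_const 2), sliceL2, eLpNorm_sq]
    _ ≤ _ := by
        gcongr
        exact hN

end hol

lemma X_bound (n : ℕ) (s : ℝ → ℝ) (hs : ContDiff ℝ (⊤ : ℕ∞) s)
    (hsupp : Function.support s ⊆ Set.Ioo (1 / 2) 2) :
    ∃ M : NNReal, ∀ (J : ℤ) (f : Rn n × ℝ → ℂ),
      Xnorm1 s (fourierMult (modLeSymbol s (J + 5)) f) ≤
        M * ENNReal.ofReal (Real.sqrt (2 ^ J)) * eLpNorm f 2 volume := by
  obtain ⟨B, hB⟩ := s_bdd s hs hsupp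
  obtain ⟨c, hc⟩ := ftST_L2 n
  obtain ⟨G, hG⟩ := geo
  refine ⟨G * (c * B * c * c * (2 * B) * c), fun J f => ?_⟩
  refine (hG J (c * B * c * c * (2 * B) * c * eLpNorm f 2 volume) _ ?_ ?_).trans (le_of_eq ?_)
  · intro k
    calc _ ≤ c * (B * (c * (c * ((2 * B : NNReal) * (c * eLpNorm f 2 volume))))) := by
          refine (fourierMult_L2 hc _ _).trans ?_
          gcongr
          refine (mul_L2 (B := B) (fun q => ?_) _).trans ?_
          · simpa [modSymbol] using hB _
          gcongr
          refine (hc _).trans ?_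
          gcongr
          refine (fourierMult_L2 hc _ _).trans ?_
          gcongr
          refine (mul_L2 (B := 2 * B) (fun q => ?_) _).trans ?_
          · rw [modLeSymbol, Complex.norm_real]
            exact sum_bdd hsupp hB _ _ (abs_nonneg _)
          gcongr
          exact hc _
      _ = _ := by push_cast; ring
  · intro k hk
    rw [← nonpos_iff_eq_zero]
    refine (fourierMult_L2 hc _ _).trans (le_of_eq ?_)
    rw [mul_eq_zero]
    right
    rw [← eLpNorm_zero (α := Rn n × ℝ) (p := 2) (μ := volume) (ε := ℂ)]
    refine eLpNorm_congr_ae ?_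
    filter_upwards [ftST_fourierMult_zero (modLeSymbol s (J + 5)) f] with q hq
    by_cases h : modSymbol s k q = 0
    · simp [h]
    · simp [hq (mod_zero hsupp k (J + 5) (by omega) q h)]
  · push_cast
    ring

theorem stmt15 (n : ℕ) (hn : 1 ≤ n)
    (s : ℝ → ℝ) (hs : ContDiff ℝ (⊤ : ℕ∞) s)
    (hsupp : Function.support s ⊆ Set.Ioo (1 / 2) 2)
    (hpart : ∀ x : ℝ, 0 < x → (∑' j : ℤ, s (x / 2 ^ j)) = 1) :
    ∃ C : ℝ, 0 < C ∧
      ∀ (jl jm : ℤ), jl ≤ jm →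
      ∀ (v : Rn n), ‖v‖ = 1 →
      ∀ (E : (ℝ × Rn (n - 1)) ≃L[ℝ] Rn n),
        (∀ (a : ℝ) (y : Rn (n - 1)), ⟪(E (a, y) : Rn n), v⟫ = a) →
        MeasurePreserving (⇑E) volume volume →
      ∀ uu vv : Rn n × ℝ → ℂ, Integrable uu volume → Integrable vv volume →
        (∀ q : Rn n × ℝ, ftST uu q ≠ 0 →
            ((2 : ℝ) ^ jl) ^ 2 / 4 ≤ |q.2| + ‖q.1‖ ^ 2 ∧
            |q.2| + ‖q.1‖ ^ 2 ≤ 4 * ((2 : ℝ) ^ jl) ^ 2) →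
        (∀ q : Rn n × ℝ, ftST vv q ≠ 0 →
            ((2 : ℝ) ^ jm) ^ 2 / 4 ≤ |q.2| + ‖q.1‖ ^ 2 ∧
            |q.2| + ‖q.1‖ ^ 2 ≤ 4 * ((2 : ℝ) ^ jm) ^ 2) →
        -- Hölder: L²_{x_θ}L^∞ × L^∞_{x_θ}L² ⊂ L²
        eLpNorm (fun p : Rn n × ℝ => uu p * vv p) 2 volume ≤
          ENNReal.ofReal C * normL2Linf E uu * normLinfL2 E vv ∧
        -- the product, truncated to modulations ≲ λμ, lies in X^{0,1/2,1}
        Xnorm1 s (fourierMult (modLeSymbol s (jl + jm + 5))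
              (fun p : Rn n × ℝ => uu p * vv p)) ≤
          ENNReal.ofReal (C * ((2 : ℝ) ^ jl) ^ ((n : ℝ) / 2)) *
            (ENNReal.ofReal (((2 : ℝ) ^ jl) ^ (-((n : ℝ) - 1) / 2)) * normL2Linf E uu) *
            (ENNReal.ofReal (((2 : ℝ) ^ jm) ^ (1 / 2 : ℝ)) * normLinfL2 E vv) := by
  obtain ⟨M, hM⟩ := X_bound n s hs hsupp
  refine ⟨M + 1, by positivity, ?_⟩
  intro jl jm _ v _ E _ hE uu vv hu hv _ _
  have hH := holder E hE uu vv hu.1 hv.1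
  refine ⟨?_, ?_⟩
  · refine hH.trans ?_
    rw [mul_assoc]
    refine le_mul_of_one_le_left' ?_
    rw [ENNReal.one_le_ofReal]
    have := M.coe_nonneg
    linarith
  · refine (hM (jl + jm) _).trans ?_
    have hl : (0 : ℝ) < 2 ^ jl := by positivity
    have hm : (0 : ℝ) < 2 ^ jm := by positivity
    have e : Real.sqrt (2 ^ (jl + jm)) = ((2 : ℝ) ^ jl) ^ ((n : ℝ) / 2) *
        ((2 : ℝ) ^ jl) ^ (-((n : ℝ) - 1) / 2) * ((2 : ℝ) ^ jm) ^ (1 / 2 : ℝ) := by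
      rw [← Real.rpow_add hl, zpow_add₀ (by norm_num), Real.sqrt_mul hl.le, Real.sqrt_eq_rpow,
        Real.sqrt_eq_rpow]
      congr 2
      ring
    rw [e, ENNReal.ofReal_mul (by positivity), ENNReal.ofReal_mul (by positivity),
      ENNReal.ofReal_mul (by positivity)]
    have hMC : (M : ℝ≥0∞) ≤ ENNReal.ofReal (M + 1) := by
      rw [← ENNReal.ofReal_coe_nnreal]
      exact ENNReal.ofReal_le_ofReal (by linarith)
    refine (mul_le_mul' (mul_le_mul' hMC le_rfl) hH).trans (le_of_eq ?_)
    ring
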